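/- For every upper unitriangular 4×4 matrix P over k and every upper unitriangular 15×15 matrix Q over k, there exists μ̄ ∈ k^12 such that the 15×4 matrix D = Q^{-1}·M(μ̄)·P has nonzero entries at all of the following (row, column) positions: (1,1), (2,1), (2,2), (3,2), (4,1), (5,1), (5,3), (6,3), (7,1), (8,1), (8,4), (9,4), (10,1), (10,2), (11,1), (11,2), (12,1), (12,3), (13,1), (13,3), (14,1), (14,4), (15,4). -/

import Mathlib

open Matrix

noncomputable section

/-- The 15×4 matrix M(μ̄) from A'Campo-Neuen's counterexample. -/
def Mmat (k : Type*) [Field k] (μ : Fin 12 → k) : Matrix (Fin 15) (Fin 4) k :=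
  !![μ 1, μ 0, 0, 0;
     μ 2, μ 1, 0, 0;
     0, μ 2, 0, 0;
     μ 3, 0, μ 0, 0;
     μ 4, 0, μ 3, 0;
     0, 0, μ 4, 0;
     μ 5, 0, 0, μ 0;
     μ 6, 0, 0, μ 5;
     0, 0, 0, μ 6;
     μ 7, μ 0, 0, 0;
     μ 8, μ 7, 0, 0;
     μ 9, 0, μ 8, 0;
     μ 10, 0, μ 9, 0;
     μ 11, 0, 0, μ 10;
     0, 0, 0, μ 11]


/-- The 23 (row, column) positions (0-indexed) at which the matrix D has nonzero entries. -/
def positions : List (Fin 15 × Fin 4) :=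
  [(0,0),(1,0),(1,1),(2,1),(3,0),(4,0),(4,2),(5,2),(6,0),(7,0),(7,3),(8,3),(9,0),(9,1),
   (10,0),(10,1),(11,0),(11,2),(12,0),(12,2),(13,0),(13,3),(14,3)]

/-- Index of the variable sitting at each entry of `Mmat` (`none` for a zero entry). -/
def Evar : Fin 15 → Fin 4 → Option (Fin 12) :=
  ![![some 1, some 0, none, none],
    ![some 2, some 1, none, none],
    ![none, some 2, none, none],
    ![some 3, none, some 0, none],
    ![some 4, none, some 3, none],
    ![none, none, some 4, none],
    ![some 5, none, none, some 0],
    ![some 6, none, none, some 5],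
    ![none, none, none, some 6],
    ![some 7, some 0, none, none],
    ![some 8, some 7, none, none],
    ![some 9, none, some 8, none],
    ![some 10, none, some 9, none],
    ![some 11, none, none, some 10],
    ![none, none, none, some 11]]

lemma Mmat_eq (k : Type*) [Field k] (μ : Fin 12 → k) (a : Fin 15) (b : Fin 4) :
    Mmat k μ a b = (Evar a b).elim 0 μ := by
  fin_cases a <;> fin_cases b <;> rfl

lemma Evar_spec : ∀ p ∈ positions, ∃ v : Fin 12, ∀ a : Fin 15, ∀ b : Fin 4, p.1 ≤ a → b ≤ p.2 →
    (Evar a b = some v ↔ a = p.1 ∧ b = p.2) := by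
  unfold positions Evar
  decide

/-- `Mmat` as a linear map. -/
def Mlin (k : Type*) [Field k] : (Fin 12 → k) →ₗ[k] Matrix (Fin 15) (Fin 4) k where
  toFun := Mmat k
  map_add' x y := by
    ext a b
    simp only [Matrix.add_apply, Mmat_eq]
    cases Evar a b <;> simp
  map_smul' c x := by
    ext a b
    simp only [Matrix.smul_apply, Mmat_eq]
    cases Evar a b <;> simp

/-- An entry of `R * Mmat * P` as a linear form. -/
def Dform (k : Type*) [Field k] (R : Matrix (Fin 15) (Fin 15) k) (P : Matrix (Fin 4) (Fin 4) k)
    (p : Fin 15 × Fin 4) : Module.Dual k (Fin 12 → k) where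
  toFun μ := (R * Mlin k μ * P) p.1 p.2
  map_add' x y := by simp [Matrix.mul_add, Matrix.add_mul]
  map_smul' c x := by simp

lemma entry_one (k : Type*) [Field k] (R : Matrix (Fin 15) (Fin 15) k)
    (P : Matrix (Fin 4) (Fin 4) k)
    (hPlow : ∀ i j : Fin 4, j < i → P i j = 0) (hPdiag : ∀ i : Fin 4, P i i = 1)
    (hRlow : ∀ i j : Fin 15, j < i → R i j = 0) (hRdiag : ∀ i : Fin 15, R i i = 1)
    (p : Fin 15 × Fin 4) (v : Fin 12)
    (hv : ∀ a : Fin 15, ∀ b : Fin 4, p.1 ≤ a → b ≤ p.2 →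
      (Evar a b = some v ↔ a = p.1 ∧ b = p.2)) :
    (R * Mmat k (Pi.single v 1) * P) p.1 p.2 = 1 := by
  have hM : ∀ a b, Mmat k (Pi.single v 1) a b = if Evar a b = some v then 1 else 0 := by
    intro a b
    rw [Mmat_eq]
    cases h : Evar a b with
    | none => simp
    | some w => simp [Pi.single_apply]
  have key : ∀ a b, R p.1 a * Mmat k (Pi.single v 1) a b * P b p.2
      = if a = p.1 then (if b = p.2 then 1 else 0) else 0 := by
    intro a b
    rcases lt_or_ge a p.1 with h | h
    · simp [hRlow _ _ h, h.ne]
    rcases lt_or_ge p.2 b with h' | h'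
    · simp [hPlow _ _ h', h'.ne']
    rw [hM, ← ite_and]
    by_cases hc : a = p.1 ∧ b = p.2
    · rw [if_pos ((hv a b h h').2 hc), if_pos hc, hc.1, hc.2, hRdiag, hPdiag]; simp
    · rw [if_neg (fun e => hc ((hv a b h h').1 e)), if_neg hc]; simp
  simp only [Matrix.mul_apply, Finset.sum_mul, key]
  simp

/-- For all upper unitriangular P (4×4) and Q (15×15), there is μ̄ such that
D = Q⁻¹·M(μ̄)·P has nonzero entries at all the listed positions. -/
theorem statement13 (k : Type*) [Field k] [IsAlgClosed k] [CharZero k]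
    (P : Matrix (Fin 4) (Fin 4) k) (Q : Matrix (Fin 15) (Fin 15) k)
    (hPlow : ∀ i j : Fin 4, j < i → P i j = 0) (hPdiag : ∀ i : Fin 4, P i i = 1)
    (hQlow : ∀ i j : Fin 15, j < i → Q i j = 0) (hQdiag : ∀ i : Fin 15, Q i i = 1) :
    ∃ μ : Fin 12 → k, ∀ p ∈ positions, (Q⁻¹ * Mmat k μ * P) p.1 p.2 ≠ 0 := by
  have hQ : Q.BlockTriangular id := fun i j h => hQlow i j h
  have hdet : Q.det = 1 := by
    rw [Matrix.det_of_upperTriangular hQ]; simp [hQdiag]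
  have hu : IsUnit Q.det := by rw [hdet]; exact isUnit_one
  haveI : Invertible Q := Matrix.invertibleOfIsUnitDet Q hu
  have hR := Matrix.blockTriangular_inv_of_blockTriangular hQ
  have hRlow : ∀ i j : Fin 15, j < i → Q⁻¹ i j = 0 := fun i j h => hR h
  have hRdiag : ∀ i : Fin 15, Q⁻¹ i i = 1 := by
    intro i
    have h := congrFun (congrFun (Matrix.mul_nonsing_inv Q hu) i) i
    rw [Matrix.mul_apply, Finset.sum_eq_single i, hQdiag, one_mul, Matrix.one_apply_eq] at h
    · exact h
    · intro b _ hb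
      rcases lt_or_gt_of_ne hb with h' | h'
      · rw [hQlow _ _ h', zero_mul]
      · rw [hRlow _ _ h', mul_zero]
    · simp
  have hne : ∀ p : {p // p ∈ positions}, Dform k Q⁻¹ P p.1 ≠ 0 := by
    rintro ⟨p, hp⟩ h0
    obtain ⟨v, hv⟩ := Evar_spec p hp
    have h1 := entry_one k Q⁻¹ P hPlow hPdiag hRlow hRdiag p v hv
    have h2 : Dform k Q⁻¹ P p (Pi.single v 1) = 1 := h1
    rw [h0] at h2
    simp at h2
  obtain ⟨μ, hμ⟩ := Module.Dual.exists_forall_ne_zero_of_forall_exists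
    (fun p : {p // p ∈ positions} => Dform k Q⁻¹ P p.1)
    (fun p => by
      by_contra! h
      exact hne p (LinearMap.ext h))
  exact ⟨μ, fun p hp => hμ ⟨p, hp⟩⟩
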